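/- Let 𝒜_p be the single-qubit amplitude damping channel of strength p. Then the twirled doubled action of 𝒜_p satisfies ∫ (V⊗V)(𝒜_p ⊗ 𝒜_p)(I/4)(V⊗V)† dV = (1−δ)(I/4) + δ(𝒮/2) with δ = p²/3, and ∫ (V⊗V)(𝒜_p ⊗ 𝒜_p)(𝒮/2)(V⊗V)† dV = γ(I/4) + (1−γ)(𝒮/2) with γ = (2/3)(2p − p²), where V is Haar distributed on U(2). -/

import Mathlib

open Matrix Kronecker MeasureTheory

noncomputable section

/-- The swap operator `𝒮` on `ℂ² ⊗ ℂ²`, `𝒮(u ⊗ v) = v ⊗ u`. -/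
def swapOp : Matrix (Fin 2 × Fin 2) (Fin 2 × Fin 2) ℂ :=
  Matrix.of fun p q => if p.1 = q.2 ∧ p.2 = q.1 then 1 else 0

/-- The single-site operators `O_0 = I/4` and `O_1 = 𝒮/2` on a doubled qubit. -/
noncomputable def O01 (b : Fin 2) : Matrix (Fin 2 × Fin 2) (Fin 2 × Fin 2) ℂ :=
  if b = 0 then (4 : ℂ)⁻¹ • 1 else (2 : ℂ)⁻¹ • swapOp

/-- Tensor product over the sites of single-site operators on the doubled space. -/
def tensorSites {ι : Type*} [Fintype ι]
    (f : ι → Matrix (Fin 2 × Fin 2) (Fin 2 × Fin 2) ℂ) :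
    Matrix (ι → Fin 2 × Fin 2) (ι → Fin 2 × Fin 2) ℂ :=
  Matrix.of fun x y => ∏ i, f i (x i) (y i)

/-- The symmetrized basis operator
`|S⟩ = C(n,S)⁻¹ ∑_{|σ| = S} ⊗ᵢ O_{σᵢ}` on the doubled space. -/
noncomputable def basisS {ι : Type*} [Fintype ι] [DecidableEq ι] (S : ℕ) :
    Matrix (ι → Fin 2 × Fin 2) (ι → Fin 2 × Fin 2) ℂ :=
  (((Fintype.card ι).choose S : ℂ))⁻¹ •
    ∑ σ ∈ Finset.univ.filter
        (fun σ : ι → Fin 2 => (Finset.univ.filter fun i => σ i = 1).card = S),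
      tensorSites fun i => O01 (σ i)

/-- `𝕊 = 𝒮^{⊗n}`: the two-copy swap applied to every site. -/
def fullSwapSites (ι : Type*) [Fintype ι] :
    Matrix (ι → Fin 2 × Fin 2) (ι → Fin 2 × Fin 2) ℂ :=
  tensorSites fun _ => swapOp

instance matrixMeasurableSpace {m n : Type*} : MeasurableSpace (Matrix m n ℂ) :=
  inferInstanceAs (MeasurableSpace (m → n → ℂ))

/-- `μ` is a (left-invariant) Haar probability measure on a group of unitaries. -/
def IsHaarProb {G : Type*} [Group G] [MeasurableSpace G] (μ : MeasureTheory.Measure G) : Prop :=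
  MeasureTheory.IsProbabilityMeasure μ ∧
    ∀ (g : G) (s : Set G), MeasurableSet s → μ ((g * ·) ⁻¹' s) = μ s

/-- The unitary group `U(2)` acting on one qubit. -/
abbrev U2 := Matrix.unitaryGroup (Fin 2) ℂ

/-- Entrywise Bochner integral of the single-qubit twirl
`V ↦ (V ⊗ V) O (V ⊗ V)†` over `μ`. -/
noncomputable def twirlAvg (μ : MeasureTheory.Measure U2)
    (O : Matrix (Fin 2 × Fin 2) (Fin 2 × Fin 2) ℂ) :
    Matrix (Fin 2 × Fin 2) (Fin 2 × Fin 2) ℂ :=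
  Matrix.of fun p q =>
    ∫ V : U2,
      ((((V : Matrix (Fin 2) (Fin 2) ℂ) ⊗ₖ (V : Matrix (Fin 2) (Fin 2) ℂ)) * O *
        (((V : Matrix (Fin 2) (Fin 2) ℂ) ⊗ₖ (V : Matrix (Fin 2) (Fin 2) ℂ))ᴴ)) p q) ∂μ

/-- The Kraus operators `A₀ = [[1,0],[0,√(1−p)]]` and `A₁ = [[0,√p],[0,0]]` of the
single-qubit amplitude damping channel of strength `p`. -/
noncomputable def ampKraus (p : ℝ) (j : Fin 2) : Matrix (Fin 2) (Fin 2) ℂ :=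
  if j = 0 then !![1, 0; 0, (Real.sqrt (1 - p) : ℂ)]
  else !![0, (Real.sqrt p : ℂ); 0, 0]

/-- The doubled amplitude damping channel `𝒜_p ⊗ 𝒜_p`, applying `𝒜_p` independently to the
two copies of a qubit. -/
noncomputable def ampDoubled (p : ℝ) (M : Matrix (Fin 2 × Fin 2) (Fin 2 × Fin 2) ℂ) :
    Matrix (Fin 2 × Fin 2) (Fin 2 × Fin 2) ℂ :=
  ∑ j : Fin 2, ∑ l : Fin 2,
    (ampKraus p j ⊗ₖ ampKraus p l) * M * (ampKraus p j ⊗ₖ ampKraus p l)ᴴ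

/-- Left multiplication by a fixed unitary is measurable. -/
lemma measurable_unitary_mul_left (g : U2) : Measurable fun V : U2 => g * V := by
  refine Measurable.subtype_mk (measurable_pi_iff.2 fun i => measurable_pi_iff.2 fun j => ?_)
  have h : ∀ a b : Fin 2, Measurable fun V : U2 => (V : Matrix (Fin 2) (Fin 2) ℂ) a b :=
    fun a b => (measurable_pi_apply b).comp ((measurable_pi_apply a).comp measurable_subtype_coe)
  simp only [Matrix.mul_apply]
  exact Finset.measurable_sum _ fun k _ => (h k j).const_mul _

/-- The two-fold tensor power `V ⊗ V`. -/
def tensorSq (V : U2) : Matrix (Fin 2 × Fin 2) (Fin 2 × Fin 2) ℂ :=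
  (V : Matrix (Fin 2) (Fin 2) ℂ) ⊗ₖ (V : Matrix (Fin 2) (Fin 2) ℂ)

lemma tensorSq_mul (V W : U2) : tensorSq (V * W) = tensorSq V * tensorSq W := by
  simp [tensorSq, Matrix.mul_kronecker_mul]

lemma tensorSq_mem_unitary (V : U2) :
    tensorSq V ∈ Matrix.unitaryGroup (Fin 2 × Fin 2) ℂ :=
  Matrix.kronecker_mem_unitary V.2 V.2

lemma tensorSq_conjTranspose_mul_self (V : U2) : (tensorSq V)ᴴ * tensorSq V = 1 :=
  Matrix.mem_unitaryGroup_iff'.1 (tensorSq_mem_unitary V)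

lemma measurable_tensorSq_apply (x y : Fin 2 × Fin 2) :
    Measurable fun V : U2 => tensorSq V x y := by
  have h : ∀ a b : Fin 2, Measurable fun V : U2 => (V : Matrix (Fin 2) (Fin 2) ℂ) a b :=
    fun a b => (measurable_pi_apply b).comp ((measurable_pi_apply a).comp measurable_subtype_coe)
  exact (h x.1 y.1).mul (h x.2 y.2)

lemma swapOp_mul_tensorSq (V : U2) : swapOp * tensorSq V = tensorSq V * swapOp := by
  ext ⟨a, b⟩ ⟨c, d⟩
  fin_cases a <;> fin_cases b <;> fin_cases c <;> fin_cases d <;>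
    simp [swapOp, tensorSq, Matrix.mul_apply, Fintype.sum_prod_type] <;> ring

lemma integrable_twirl_apply (μ : Measure U2) [IsProbabilityMeasure μ]
    (O : Matrix (Fin 2 × Fin 2) (Fin 2 × Fin 2) ℂ) (x y : Fin 2 × Fin 2) :
    Integrable (fun V : U2 => (tensorSq V * O * (tensorSq V)ᴴ) x y) μ := by
  simp only [Matrix.mul_apply, Finset.sum_mul, Matrix.conjTranspose_apply]
  refine integrable_finsetSum _ fun k _ => integrable_finsetSum _ fun l _ => ?_
  refine Integrable.of_bound (C := ‖O l k‖) ?_ (ae_of_all _ fun V => ?_)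
  · exact (((measurable_tensorSq_apply x l).mul_const _).mul
      (continuous_star.measurable.comp (measurable_tensorSq_apply y k))).aestronglyMeasurable
  · rw [norm_mul, norm_mul, norm_star]
    have h1 := entry_norm_bound_of_unitary (tensorSq_mem_unitary V) x l
    have h2 := entry_norm_bound_of_unitary (tensorSq_mem_unitary V) y k
    calc _ ≤ 1 * ‖O l k‖ * 1 := by gcongr
      _ = ‖O l k‖ := by ring

lemma twirlAvg_apply (μ : Measure U2) (O : Matrix (Fin 2 × Fin 2) (Fin 2 × Fin 2) ℂ)
    (x y : Fin 2 × Fin 2) :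
    twirlAvg μ O x y = ∫ V : U2, (tensorSq V * O * (tensorSq V)ᴴ) x y ∂μ := rfl

lemma mul_twirlAvg_mul_apply (μ : Measure U2) [IsProbabilityMeasure μ]
    (A B O : Matrix (Fin 2 × Fin 2) (Fin 2 × Fin 2) ℂ) (x y : Fin 2 × Fin 2) :
    (A * twirlAvg μ O * B) x y =
      ∫ V : U2, (A * (tensorSq V * O * (tensorSq V)ᴴ) * B) x y ∂μ := by
  have hi := integrable_twirl_apply μ O
  rw [Matrix.mul_apply]
  simp_rw [Matrix.mul_apply (M := A * _) (N := B), Matrix.mul_apply (M := A), twirlAvg_apply]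
  rw [integral_finsetSum _ fun k _ =>
    (integrable_finsetSum _ fun l _ => (hi l k).const_mul _).mul_const _]
  refine Finset.sum_congr rfl fun k _ => ?_
  rw [integral_mul_const, integral_finsetSum _ fun l _ => (hi l k).const_mul _]
  simp_rw [integral_const_mul]

/-- The Haar twirl commutes with `W ⊗ W` for every unitary `W`. -/
lemma tensorSq_mul_twirlAvg (μ : Measure U2) (hμ : IsHaarProb μ)
    (O : Matrix (Fin 2 × Fin 2) (Fin 2 × Fin 2) ℂ) (W : U2) :
    tensorSq W * twirlAvg μ O = twirlAvg μ O * tensorSq W := by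
  have := hμ.1
  have hmap : μ.map (fun V => W * V) = μ := by
    ext s hs
    rw [Measure.map_apply (measurable_unitary_mul_left W) hs]
    exact hμ.2 W s hs
  have hconj : tensorSq W * twirlAvg μ O * (tensorSq W)ᴴ = twirlAvg μ O := by
    ext x y
    rw [mul_twirlAvg_mul_apply, twirlAvg_apply]
    conv_rhs => rw [← hmap]
    rw [integral_map (measurable_unitary_mul_left W).aemeasurable
      (by rw [hmap]; exact (integrable_twirl_apply μ O x y).aestronglyMeasurable)]
    simp only [tensorSq_mul, Matrix.conjTranspose_mul, Matrix.mul_assoc]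
  calc tensorSq W * twirlAvg μ O
      = tensorSq W * twirlAvg μ O * ((tensorSq W)ᴴ * tensorSq W) := by
        rw [tensorSq_conjTranspose_mul_self, Matrix.mul_one]
    _ = twirlAvg μ O * tensorSq W := by rw [← Matrix.mul_assoc, hconj]

/-- The twirl preserves the trace against any operator commuting with all `V ⊗ V`. -/
lemma trace_mul_twirlAvg (μ : Measure U2) [IsProbabilityMeasure μ]
    (A O : Matrix (Fin 2 × Fin 2) (Fin 2 × Fin 2) ℂ)
    (hA : ∀ V, A * tensorSq V = tensorSq V * A) :
    (A * twirlAvg μ O).trace = (A * O).trace := by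
  have hi (x : Fin 2 × Fin 2) :
      Integrable (fun V : U2 => (A * (tensorSq V * O * (tensorSq V)ᴴ)) x x) μ := by
    simp only [Matrix.mul_apply (M := A)]
    exact integrable_finsetSum _ fun l _ => (integrable_twirl_apply μ O l x).const_mul _
  have h (x : Fin 2 × Fin 2) : (A * twirlAvg μ O) x x =
      ∫ V : U2, (A * (tensorSq V * O * (tensorSq V)ᴴ)) x x ∂μ := by
    simpa using mul_twirlAvg_mul_apply μ A 1 O x x
  have hc (V : U2) : (A * (tensorSq V * O * (tensorSq V)ᴴ)).trace = (A * O).trace := by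
    rw [← Matrix.mul_assoc, ← Matrix.mul_assoc, hA, Matrix.trace_mul_comm, Matrix.mul_assoc,
      ← Matrix.mul_assoc, tensorSq_conjTranspose_mul_self, Matrix.one_mul]
  calc (A * twirlAvg μ O).trace
      = ∑ x, ∫ V : U2, (A * (tensorSq V * O * (tensorSq V)ᴴ)) x x ∂μ :=
        Finset.sum_congr rfl fun x _ => h x
    _ = ∫ V : U2, (A * (tensorSq V * O * (tensorSq V)ᴴ)).trace ∂μ :=
        (integral_finsetSum _ fun x _ => hi x).symm
    _ = (A * O).trace := by simp [hc]

/-- The phase gate `diag(1, i)`. -/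
def phaseGate : U2 :=
  ⟨!![1, 0; 0, Complex.I], by
    rw [Matrix.mem_unitaryGroup_iff]
    ext i j
    fin_cases i <;> fin_cases j <;> simp [Matrix.mul_apply, Matrix.star_apply]⟩

/-- A reflection with rational entries, mixing the two basis states. -/
def rationalReflection : U2 :=
  ⟨!![3 / 5, 4 / 5; 4 / 5, -3 / 5], by
    have h (n : ℕ) [n.AtLeastTwo] : (starRingEnd ℂ) (OfNat.ofNat n) = OfNat.ofNat n :=
      Complex.conj_ofNat n
    rw [Matrix.mem_unitaryGroup_iff]
    ext i j
    fin_cases i <;> fin_cases j <;> simp [Matrix.mul_apply, Matrix.star_apply, h] <;>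
      norm_num⟩

/-- An operator commuting with all `W ⊗ W` is a combination of the identity and the swap. -/
lemma eq_smul_one_add_smul_swapOp_of_commute (T : Matrix (Fin 2 × Fin 2) (Fin 2 × Fin 2) ℂ)
    (hT : ∀ W, tensorSq W * T = T * tensorSq W) :
    T = T (0, 1) (0, 1) • (1 : Matrix (Fin 2 × Fin 2) (Fin 2 × Fin 2) ℂ) +
      T (0, 1) (1, 0) • swapOp := by
  have hP (x y : Fin 2 × Fin 2) := congrFun (congrFun (hT phaseGate) x) y
  have hR (x y : Fin 2 × Fin 2) := congrFun (congrFun (hT rationalReflection) x) y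
  simp only [tensorSq, phaseGate, rationalReflection, Matrix.mul_apply, Fintype.sum_prod_type,
    Fin.sum_univ_two, Matrix.kroneckerMap_apply] at hP hR
  have hne : (1 : ℂ) ≠ Complex.I := by simp [Complex.ext_iff]
  have hne' : (1 : ℂ) ≠ -1 := by norm_num
  have hne'' : Complex.I ≠ -1 := by simp [Complex.ext_iff]
  have hz {c d t : ℂ} (hcd : c ≠ d) (h : c * t = t * d) : t = 0 := by
    have : (c - d) * t = 0 := by linear_combination h
    exact (mul_eq_zero.1 this).resolve_left (sub_ne_zero.2 hcd)
  have z1 : T (0, 0) (0, 1) = 0 := hz hne (by simpa using hP (0, 0) (0, 1))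
  have z2 : T (0, 0) (1, 0) = 0 := hz hne (by simpa using hP (0, 0) (1, 0))
  have z3 : T (0, 0) (1, 1) = 0 := hz hne' (by simpa using hP (0, 0) (1, 1))
  have z4 : T (0, 1) (0, 0) = 0 := hz hne.symm (by simpa using hP (0, 1) (0, 0))
  have z5 : T (1, 0) (0, 0) = 0 := hz hne.symm (by simpa using hP (1, 0) (0, 0))
  have z6 : T (1, 1) (0, 0) = 0 := hz hne'.symm (by simpa using hP (1, 1) (0, 0))
  have z7 : T (0, 1) (1, 1) = 0 := hz hne'' (by simpa using hP (0, 1) (1, 1))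
  have z8 : T (1, 0) (1, 1) = 0 := hz hne'' (by simpa using hP (1, 0) (1, 1))
  have z9 : T (1, 1) (0, 1) = 0 := hz hne''.symm (by simpa using hP (1, 1) (0, 1))
  have z10 : T (1, 1) (1, 0) = 0 := hz hne''.symm (by simpa using hP (1, 1) (1, 0))
  have e1 := hR (0, 0) (0, 1)
  have e2 := hR (0, 0) (1, 0)
  have e3 := hR (0, 1) (0, 0)
  have e4 := hR (0, 1) (1, 1)
  simp [z1, z2, z3, z4, z5, z6, z7, z8, z9, z10] at e1 e2 e3 e4
  have f1 : T (0, 0) (0, 0) = T (0, 1) (0, 1) + T (0, 1) (1, 0) := by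
    linear_combination (25 / 12) * e3
  have f2 : T (1, 1) (1, 1) = T (0, 1) (0, 1) + T (0, 1) (1, 0) := by
    linear_combination -(25 / 12) * e4
  have f3 : T (1, 0) (0, 1) = T (0, 1) (1, 0) := by
    linear_combination (25 / 12) * e1 + f1
  have f4 : T (1, 0) (1, 0) = T (0, 1) (0, 1) := by
    linear_combination (25 / 12) * e2 + f1
  ext ⟨a, b⟩ ⟨c, d⟩
  fin_cases a <;> fin_cases b <;> fin_cases c <;> fin_cases d <;>
    simp [swapOp, z1, z2, z3, z4, z5, z6, z7, z8, z9, z10, f1, f2, f3, f4]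

/-- The Haar twirl onto the span of `I/4` and `𝒮/2`, with coefficients fixed by two traces. -/
lemma twirlAvg_eq_of_trace (μ : Measure U2) (hμ : IsHaarProb μ)
    (O : Matrix (Fin 2 × Fin 2) (Fin 2 × Fin 2) ℂ) (α β : ℂ)
    (h1 : O.trace = α + β) (h2 : (swapOp * O).trace = α / 2 + 2 * β) :
    twirlAvg μ O = α • O01 0 + β • O01 1 := by
  have := hμ.1
  have hT := eq_smul_one_add_smul_swapOp_of_commute _ (tensorSq_mul_twirlAvg μ hμ O)
  have t1 := trace_mul_twirlAvg μ 1 O (by simp)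
  have t2 := trace_mul_twirlAvg μ swapOp O swapOp_mul_tensorSq
  rw [Matrix.one_mul, Matrix.one_mul, h1] at t1
  rw [h2] at t2
  generalize twirlAvg μ O (0, 1) (0, 1) = s at hT
  generalize twirlAvg μ O (0, 1) (1, 0) = t at hT
  rw [hT] at t1 t2 ⊢
  have hS : swapOp.trace = 2 := by
    simp only [Matrix.trace, Matrix.diag_apply, swapOp, Matrix.of_apply, Fintype.sum_prod_type,
      Fin.sum_univ_two]
    norm_num
  have hSS : swapOp * swapOp = 1 := by
    ext ⟨a, b⟩ ⟨c, d⟩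
    fin_cases a <;> fin_cases b <;> fin_cases c <;> fin_cases d <;>
      simp [swapOp, Matrix.mul_apply, Fintype.sum_prod_type]
  simp [Matrix.mul_add, hS, hSS] at t1 t2
  have hs : s = α / 4 := by linear_combination (1 / 3) * t1 - (1 / 6) * t2
  have ht : t = β / 2 := by linear_combination (1 / 3) * t2 - (1 / 6) * t1
  simp [O01, hs, ht, smul_smul, div_eq_mul_inv]

/-- The twirled doubled action of amplitude damping noise satisfies
`∫ (V⊗V)(𝒜_p⊗𝒜_p)(I/4)(V⊗V)† dV = (1−δ)(I/4) + δ(𝒮/2)` with `δ = p²/3` and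
`∫ (V⊗V)(𝒜_p⊗𝒜_p)(𝒮/2)(V⊗V)† dV = γ(I/4) + (1−γ)(𝒮/2)` with `γ = (2/3)(2p − p²)`. -/
theorem amplitude_damping_transfer_params
    (p : ℝ) (hp0 : 0 ≤ p) (hp1 : p ≤ 1)
    (μ : Measure U2) (hμ : IsHaarProb μ) :
    twirlAvg μ (ampDoubled p (O01 0)) =
        ((1 - p ^ 2 / 3 : ℝ) : ℂ) • O01 0 + ((p ^ 2 / 3 : ℝ) : ℂ) • O01 1 ∧
      twirlAvg μ (ampDoubled p (O01 1)) =
        ((2 / 3 * (2 * p - p ^ 2) : ℝ) : ℂ) • O01 0 +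
          ((1 - 2 / 3 * (2 * p - p ^ 2) : ℝ) : ℂ) • O01 1 := by
  have hq : ((Real.sqrt p : ℝ) : ℂ) ^ 2 = p := by
    rw [← Complex.ofReal_pow, Real.sq_sqrt hp0]
  have hr : ((Real.sqrt (1 - p) : ℝ) : ℂ) ^ 2 = 1 - p := by
    rw [← Complex.ofReal_pow, Real.sq_sqrt (by linarith)]
    simp
  constructor <;> refine twirlAvg_eq_of_trace μ hμ _ _ _ ?_ ?_ <;>
    simp only [ampDoubled, ampKraus, O01, swapOp, Matrix.trace, Matrix.diag_apply,
      Matrix.mul_apply, Matrix.add_apply, Fintype.sum_prod_type, Fin.sum_univ_two,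
      Matrix.of_apply, Matrix.conjTranspose_apply,
      Matrix.kroneckerMap_apply] <;>
    simp <;>
    generalize ((Real.sqrt p : ℝ) : ℂ) = q at * <;>
    generalize ((Real.sqrt (1 - p) : ℝ) : ℂ) = r at *
  all_goals
    have hq4 : q ^ 4 = (p : ℂ) ^ 2 := by rw [← hq]; ring
    have hr4 : r ^ 4 = (1 - p : ℂ) ^ 2 := by rw [← hr]; ring
    have hqr : q ^ 2 * r ^ 2 = (p : ℂ) * (1 - p) := by rw [hq, hr]
  · linear_combination (1 / 2) * hq + (1 / 2) * hr + (1 / 4) * hq4 + (1 / 2) * hqr + (1 / 4) * hr4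
  · linear_combination (1 / 2) * hq + (1 / 4) * hq4 + (1 / 4) * hr4
  · linear_combination (1 / 2) * hq4 + hqr + (1 / 2) * hr4
  · linear_combination (1 / 2) * hq4 + hr + (1 / 2) * hr4
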